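/- Let Δ(τ) = η(τ)²⁴ and let f : ℍ → ℂ be defined by f(τ) = (1/38818159380)·( (E₆(τ)⁴ + 1341·E₆(τ)²·Δ(τ) + 201894·Δ(τ)²)·(DE₄)(τ)/(240·η(τ)⁵⁸) − (E₆(τ)³·Δ(τ) + 879·E₆(τ)·Δ(τ)²)/η(τ)⁵⁸ ), where (DE₄)(τ) = 240∑_{n≥1} n·σ₃(n)qⁿ. Then f is holomorphic on ℍ and satisfies the second-order modular linear differential equation D²f − (1/6)·E₂·Df − (899/144)·E₄·f = 0 on ℍ (this is the MLDE of weight 0 with parameter h = 30, since (h−1)(h+1)/144 = 899/144). (In the paper, f is the normalized character of the simple affine vertex algebra V_{−6}(E₈).) -/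

import Mathlib

noncomputable section

open Complex

/-- `q = exp(2πiτ)`. -/
def qc (τ : ℂ) : ℂ := Complex.exp (2 * (Real.pi : ℂ) * Complex.I * τ)

/-- `σ_k(n) = ∑_{d ∣ n} d^k`, as a complex number. -/
def sigmaC (k n : ℕ) : ℂ := ∑ d ∈ n.divisors, (d : ℂ) ^ k

/-- Eisenstein series `E₂(τ) = 1 - 24 ∑_{n≥1} σ₁(n) qⁿ`. -/
def E2 (τ : ℂ) : ℂ := 1 - 24 * ∑' n : ℕ, sigmaC 1 (n + 1) * qc τ ^ (n + 1)

/-- Eisenstein series `E₄(τ) = 1 + 240 ∑_{n≥1} σ₃(n) qⁿ`. -/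
def E4 (τ : ℂ) : ℂ := 1 + 240 * ∑' n : ℕ, sigmaC 3 (n + 1) * qc τ ^ (n + 1)

/-- Eisenstein series `E₆(τ) = 1 - 504 ∑_{n≥1} σ₅(n) qⁿ`. -/
def E6 (τ : ℂ) : ℂ := 1 - 504 * ∑' n : ℕ, sigmaC 5 (n + 1) * qc τ ^ (n + 1)

/-- The normalized derivative of `E₄`: `(DE₄)(τ) = 240 ∑_{n≥1} n σ₃(n) qⁿ`. -/
def DE4 (τ : ℂ) : ℂ := 240 * ∑' n : ℕ, ((n : ℂ) + 1) * sigmaC 3 (n + 1) * qc τ ^ (n + 1)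

/-- Dedekind eta function `η(τ) = exp(2πiτ/24) ∏_{n≥1} (1 - qⁿ)`. -/
def dedekindEta (τ : ℂ) : ℂ :=
  Complex.exp (2 * (Real.pi : ℂ) * Complex.I * τ / 24) * ∏' n : ℕ, (1 - qc τ ^ (n + 1))

/-- Normalized derivative `D = (2πi)⁻¹ d/dτ`. -/
def Dop (f : ℂ → ℂ) : ℂ → ℂ := fun τ => (2 * (Real.pi : ℂ) * Complex.I)⁻¹ * deriv f τ

/-- The upper half-plane, as a subset of `ℂ`. -/
def UHP : Set ℂ := {τ : ℂ | 0 < τ.im}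

/-- The modular discriminant `Δ(τ) = η(τ)²⁴`. -/
def Delta (τ : ℂ) : ℂ := dedekindEta τ ^ 24

/-- The normalized character of `V_{-6}(E₈)`. -/
def charE8 (τ : ℂ) : ℂ :=
  (1 / 38818159380) *
    ((E6 τ ^ 4 + 1341 * E6 τ ^ 2 * Delta τ + 201894 * Delta τ ^ 2) * DE4 τ
        / (240 * dedekindEta τ ^ 58)
      - (E6 τ ^ 3 * Delta τ + 879 * E6 τ * Delta τ ^ 2) / dedekindEta τ ^ 58)


/-- The differentiated divisor series. -/
def Sser (k j : ℕ) (τ : ℂ) : ℂ :=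
  ∑' n : ℕ, ((n : ℂ) + 1) ^ j * sigmaC k (n + 1) * qc τ ^ (n + 1)

lemma sigmaC_eq (k n : ℕ) : sigmaC k n = (ArithmeticFunction.sigma k n : ℂ) := by
  simp [sigmaC, ArithmeticFunction.sigma_apply]

lemma norm_sigmaC_le (k n : ℕ) : ‖sigmaC k n‖ ≤ (n : ℝ) ^ (k + 1) := by
  rw [sigmaC_eq, Complex.norm_natCast]
  exact_mod_cast ArithmeticFunction.sigma_le_pow_succ k n

lemma norm_qc (τ : ℂ) : ‖qc τ‖ = Real.exp (-2 * Real.pi * τ.im) := by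
  simp [qc, Complex.norm_exp]

lemma norm_qc_lt_one {τ : ℂ} (h : τ ∈ UHP) : ‖qc τ‖ < 1 := by
  rw [norm_qc, Real.exp_lt_one_iff]
  have h' : 0 < τ.im := h
  nlinarith [Real.pi_pos, mul_pos Real.pi_pos h']

lemma term_bound (k j n : ℕ) (τ : ℂ) :
    ‖((n : ℂ) + 1) ^ j * sigmaC k (n + 1) * qc τ ^ (n + 1)‖
      ≤ ((n : ℝ) + 1) ^ (j + k + 1) * ‖qc τ‖ ^ (n + 1) := by
  have h1 : ‖(n : ℂ) + 1‖ = (n : ℝ) + 1 := by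
    rw [← Nat.cast_succ, Complex.norm_natCast]; simp
  rw [norm_mul, norm_mul, norm_pow, norm_pow, h1]
  have := norm_sigmaC_le k (n + 1)
  push_cast at this
  calc _ ≤ ((n : ℝ) + 1) ^ j * ((n : ℝ) + 1) ^ (k + 1) * ‖qc τ‖ ^ (n + 1) := by gcongr
    _ = _ := by ring

lemma summable_bound (m : ℕ) {r : ℝ} (h0 : 0 ≤ r) (h : r < 1) :
    Summable fun n : ℕ => ((n : ℝ) + 1) ^ m * r ^ (n + 1) := by
  have := summable_norm_pow_mul_geometric_of_norm_lt_one (R := ℝ) m (r := r)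
    (by rwa [Real.norm_of_nonneg h0])
  have h2 := (summable_nat_add_iff 1).mpr this
  refine h2.congr fun n => ?_
  rw [Real.norm_of_nonneg (by positivity)]
  push_cast
  ring

lemma summable_Sser (k j : ℕ) {τ : ℂ} (h : τ ∈ UHP) :
    Summable fun n : ℕ => ((n : ℂ) + 1) ^ j * sigmaC k (n + 1) * qc τ ^ (n + 1) :=
  Summable.of_norm_bounded (summable_bound (j + k + 1) (norm_nonneg _) (norm_qc_lt_one h))
    fun n => term_bound k j n τ

lemma hasDerivAt_qc (τ : ℂ) :
    HasDerivAt qc (2 * (Real.pi : ℂ) * Complex.I * qc τ) τ := by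
  unfold qc
  have h := ((hasDerivAt_id τ).const_mul (2 * (Real.pi : ℂ) * Complex.I)).cexp
  refine h.congr_deriv ?_
  simp only [id]
  ring

lemma hasDerivAt_Sser (k j : ℕ) {τ : ℂ} (h : τ ∈ UHP) :
    HasDerivAt (Sser k j) (2 * (Real.pi : ℂ) * Complex.I * Sser k (j + 1) τ) τ := by
  have h' : 0 < τ.im := h
  set y := τ.im / 2 with hy
  have hyp : 0 < y := by positivity
  set r := Real.exp (-2 * Real.pi * y) with hr
  have hr1 : r < 1 := by
    rw [hr, Real.exp_lt_one_iff]; nlinarith [mul_pos Real.pi_pos hyp]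
  have hconv : Convex ℝ {z : ℂ | y < z.im} := convex_halfSpace_im_gt y
  have hop : IsOpen {z : ℂ | y < z.im} := isOpen_lt continuous_const Complex.continuous_im
  have hmem : τ ∈ {z : ℂ | y < z.im} := by simp only [Set.mem_ofPred_eq]; linarith
  have key := hasDerivAt_tsum_of_isPreconnected (𝕜 := ℂ)
    (u := fun n : ℕ => ‖2 * (Real.pi : ℂ) * Complex.I‖ *
      (((n : ℝ) + 1) ^ (j + 1 + k + 1) * r ^ (n + 1)))
    (g := fun (n : ℕ) τ => ((n : ℂ) + 1) ^ j * sigmaC k (n + 1) * qc τ ^ (n + 1))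
    (g' := fun (n : ℕ) τ => 2 * (Real.pi : ℂ) * Complex.I *
      (((n : ℂ) + 1) ^ (j + 1) * sigmaC k (n + 1) * qc τ ^ (n + 1)))
    (t := {z : ℂ | y < z.im}) (y₀ := τ) (y := τ)
    ((summable_bound _ (Real.exp_pos _).le hr1).mul_left _) hop hconv.isPreconnected
    ?_ ?_ hmem (summable_Sser k j h) hmem
  · rw [tsum_mul_left] at key
    exact key
  · intro n z _
    have := ((hasDerivAt_qc z).pow (n + 1)).const_mul (((n : ℂ) + 1) ^ j * sigmaC k (n + 1))
    refine this.congr_deriv ?_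
    simp only [Nat.add_sub_cancel]
    push_cast
    ring
  · intro n z hz
    rw [norm_mul]
    gcongr
    refine (term_bound k (j + 1) n z).trans ?_
    gcongr
    rw [norm_qc, hr]
    apply Real.exp_le_exp.mpr
    have : y < z.im := hz
    nlinarith [Real.pi_pos]

open UpperHalfPlane Filter Topology in
lemma tendsto_Sser (k j : ℕ) :
    Tendsto (fun z : ℍ => Sser k j (z : ℂ)) atImInfty (𝓝 0) := by
  have hq : Tendsto (fun z : ℍ => ‖qc (z : ℂ)‖) atImInfty (𝓝 0) := by
    have := (UpperHalfPlane.qParam_tendsto_atImInfty (h := 1) one_pos).norm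
    simp only [norm_zero] at this
    refine this.congr fun z => ?_
    simp [qc, Function.Periodic.qParam]
  set C := ∑' n : ℕ, ((n : ℝ) + 1) ^ (j + k + 1) * (1 / 2 : ℝ) ^ (n + 1) with hC
  have hs := summable_bound (j + k + 1) (r := 1 / 2) (by norm_num) (by norm_num)
  refine squeeze_zero_norm' (a := fun z : ℍ => 2 * C * ‖qc (z : ℂ)‖) ?_ ?_
  · filter_upwards [hq.eventually (gt_mem_nhds (show (0 : ℝ) < 1 / 2 by norm_num))] with z hz
    have hb : ∀ n : ℕ, ‖((n : ℂ) + 1) ^ j * sigmaC k (n + 1) * qc z ^ (n + 1)‖ ≤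
        2 * ‖qc (z : ℂ)‖ * (((n : ℝ) + 1) ^ (j + k + 1) * (1 / 2 : ℝ) ^ (n + 1)) := by
      intro n
      refine (term_bound k j n z).trans ?_
      have : ‖qc (z : ℂ)‖ ^ n ≤ (1 / 2) ^ n := by gcongr
      calc _ = ((n : ℝ) + 1) ^ (j + k + 1) * ‖qc (z : ℂ)‖ * ‖qc (z : ℂ)‖ ^ n := by ring
        _ ≤ ((n : ℝ) + 1) ^ (j + k + 1) * ‖qc (z : ℂ)‖ * (1 / 2) ^ n := by gcongr
        _ = _ := by ring
    refine (tsum_of_norm_bounded ((hs.mul_left (2 * ‖qc (z : ℂ)‖)).hasSum) hb).trans_eq ?_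
    rw [tsum_mul_left, ← hC]
    ring
  · simpa using hq.const_mul (2 * C)

lemma E2_eq (τ : ℂ) : E2 τ = 1 - 24 * Sser 1 0 τ := by simp [E2, Sser]
lemma E4_eq (τ : ℂ) : E4 τ = 1 + 240 * Sser 3 0 τ := by simp [E4, Sser]
lemma E6_eq (τ : ℂ) : E6 τ = 1 - 504 * Sser 5 0 τ := by simp [E6, Sser]
lemma DE4_eq (τ : ℂ) : DE4 τ = 240 * Sser 3 1 τ := by simp [DE4, Sser]

lemma isOpen_UHP : IsOpen UHP := isOpen_lt continuous_const Complex.continuous_im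

/-! ### Comparison with Mathlib's objects -/

open UpperHalfPlane in
lemma mE2 (z : ℍ) : EisensteinSeries.E2 z = E2 z := by
  rw [EisensteinSeries.E2_eq_tsum_cexp, E2,
    tsum_pnat_eq_tsum_succ (f := fun n : ℕ =>
      (ArithmeticFunction.sigma 1 n : ℂ) * cexp (2 * Real.pi * Complex.I * z) ^ n)]
  simp [sigmaC_eq, qc]

open UpperHalfPlane ModularForm in
lemma mE4 (z : ℍ) : E₄ z = E4 z := by
  rw [EisensteinSeries.q_expansion_bernoulli _ ⟨2, rfl⟩, E4,
    tsum_pnat_eq_tsum_succ (f := fun n : ℕ =>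
      (ArithmeticFunction.sigma 3 n : ℂ) * cexp (2 * Real.pi * Complex.I * z) ^ (n : ℤ))]
  norm_num [sigmaC_eq, qc, show bernoulli 4 = -1 / 30 by decide +kernel]
  norm_cast

open UpperHalfPlane ModularForm in
lemma mE6 (z : ℍ) : E₆ z = E6 z := by
  rw [EisensteinSeries.q_expansion_bernoulli _ ⟨3, rfl⟩, E6,
    tsum_pnat_eq_tsum_succ (f := fun n : ℕ =>
      (ArithmeticFunction.sigma 5 n : ℂ) * cexp (2 * Real.pi * Complex.I * z) ^ (n : ℤ))]
  norm_num [sigmaC_eq, qc, show bernoulli 6 = 1 / 42 by decide +kernel]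
  norm_cast

lemma eta_eq_dedekindEta (z : ℂ) : ModularForm.eta z = dedekindEta z := by
  simp [ModularForm.eta, dedekindEta, ModularForm.eta_q, qc, Function.Periodic.qParam]

/-! ### Ramanujan's identities -/

lemma two_pi_I_ne : 2 * (Real.pi : ℂ) * Complex.I ≠ 0 := by
  simp [Real.pi_ne_zero]

lemma hasDerivAt_E2' {τ : ℂ} (h : τ ∈ UHP) :
    HasDerivAt E2 (2 * (Real.pi : ℂ) * Complex.I * (-24 * Sser 1 1 τ)) τ := by
  have := ((hasDerivAt_Sser 1 0 h).const_mul 24).const_sub 1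
  rw [show E2 = fun τ => 1 - 24 * Sser 1 0 τ from funext E2_eq]
  exact this.congr_deriv (by ring)

lemma hasDerivAt_E4' {τ : ℂ} (h : τ ∈ UHP) :
    HasDerivAt E4 (2 * (Real.pi : ℂ) * Complex.I * (240 * Sser 3 1 τ)) τ := by
  have := ((hasDerivAt_Sser 3 0 h).const_mul 240).const_add 1
  rw [show E4 = fun τ => 1 + 240 * Sser 3 0 τ from funext E4_eq]
  exact this.congr_deriv (by ring)

lemma hasDerivAt_E6' {τ : ℂ} (h : τ ∈ UHP) :
    HasDerivAt E6 (2 * (Real.pi : ℂ) * Complex.I * (-504 * Sser 5 1 τ)) τ := by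
  have := ((hasDerivAt_Sser 5 0 h).const_mul 504).const_sub 1
  rw [show E6 = fun τ => 1 - 504 * Sser 5 0 τ from funext E6_eq]
  exact this.congr_deriv (by ring)

section
open UpperHalfPlane Filter Topology ModularForm Derivative
open scoped MatrixGroups Manifold

lemma normD_eq {F : ℍ → ℂ} {G : ℂ → ℂ} (hFG : ∀ z : ℍ, F z = G z) {z : ℍ} {d : ℂ}
    (hG : HasDerivAt G (2 * (Real.pi : ℂ) * Complex.I * d) (z : ℂ)) :
    normalizedDerivOfComplex F z = d := by
  have he : (F ∘ ofComplex) =ᶠ[𝓝 (z : ℂ)] G := by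
    filter_upwards [isOpen_upperHalfPlaneSet.mem_nhds z.im_pos] with w hw
    rw [Function.comp_apply, hFG, ofComplex_apply_of_im_pos hw]
  rw [normalizedDerivOfComplex, he.deriv_eq, hG.deriv, ← mul_assoc,
    inv_mul_cancel₀ two_pi_I_ne, one_mul]

lemma normD_E2 (z : ℍ) : normalizedDerivOfComplex EisensteinSeries.E2 z = -24 * Sser 1 1 z :=
  normD_eq mE2 (hasDerivAt_E2' z.im_pos)

lemma normD_E4 (z : ℍ) : normalizedDerivOfComplex E₄ z = 240 * Sser 3 1 z :=
  normD_eq mE4 (hasDerivAt_E4' z.im_pos)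

lemma normD_E6 (z : ℍ) : normalizedDerivOfComplex E₆ z = -504 * Sser 5 1 z :=
  normD_eq mE6 (hasDerivAt_E6' z.im_pos)

lemma tendsto_E2 : Tendsto (fun z : ℍ => E2 z) atImInfty (𝓝 1) := by
  simp_rw [E2_eq]
  simpa using ((tendsto_Sser 1 0).const_mul 24).const_sub 1

lemma tendsto_E4 : Tendsto (fun z : ℍ => E4 z) atImInfty (𝓝 1) := by
  simp_rw [E4_eq]
  simpa using ((tendsto_Sser 3 0).const_mul 240).const_add 1

lemma tendsto_E6 : Tendsto (fun z : ℍ => E6 z) atImInfty (𝓝 1) := by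
  simp_rw [E6_eq]
  simpa using ((tendsto_Sser 5 0).const_mul 504).const_sub 1

/-- A level one form of weight `< 12` vanishing at the cusp is zero. -/
lemma eq_zero_of_cusp {k : ℤ} (hk : k < 12) (H : ℍ → ℂ) (hd : MDiff H)
    (hs : ∀ γ : SL(2, ℤ), H ∣[k] γ = H) (ht : Tendsto H atImInfty (𝓝 0)) (z : ℍ) : H z = 0 := by
  let f : CuspForm 𝒮ℒ k :=
    { toFun := H
      slash_action_eq' := by
        rintro A ⟨γ, rfl⟩
        exact hs γ
      holo' := hd
      zero_at_cusps' := by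
        intro c hc
        rw [Subgroup.IsArithmetic.isCusp_iff_isCusp_SL2Z] at hc
        rw [OnePoint.isZeroAt_iff_forall_SL2Z hc]
        intro γ _
        rw [hs]
        exact ht }
  have hf : f = 0 := rank_zero_iff_forall_zero.mp (CuspForm.rank_eq_zero_of_weight_lt_twelve hk) f
  have : f z = 0 := by rw [hf]; rfl
  exact this

lemma slash_E4 (γ : SL(2, ℤ)) : (E₄ : ℍ → ℂ) ∣[(4 : ℤ)] γ = E₄ :=
  SlashInvariantForm.slash_action_eqn E₄ _ ⟨γ, rfl⟩

lemma slash_E6 (γ : SL(2, ℤ)) : (E₆ : ℍ → ℂ) ∣[(6 : ℤ)] γ = E₆ :=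
  SlashInvariantForm.slash_action_eqn E₆ _ ⟨γ, rfl⟩

lemma ram_E4 (z : ℍ) : 240 * Sser 3 1 z = (E2 z * E4 z - E6 z) / 3 := by
  have key := eq_zero_of_cusp (k := 6) (by norm_num)
    (serreDerivative ((4 : ℤ) : ℂ) E₄ + (1 / 3 : ℂ) • (E₆ : ℍ → ℂ))
    ((serreDerivative_mdifferentiable _ E₄.holo').add (E₆.holo'.const_smul _)) ?_ ?_ z
  · simp only [Pi.add_apply, Pi.smul_apply, serreDerivative_apply, normD_E4, mE2, mE4, mE6,
      smul_eq_mul] at key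
    push_cast at key
    linear_combination key
  · intro γ
    rw [SlashAction.add_slash, ModularForm.SL_smul_slash, slash_E6]
    congr 1
    exact serreDerivative_slash_invariant (k := 4) E₄.holo' (slash_E4 γ)
  · have h : Tendsto (fun z : ℍ => 240 * Sser 3 1 z - (4 : ℂ) * 12⁻¹ * (E2 z) * E4 z +
        (1 / 3 : ℂ) * E6 z) atImInfty (𝓝 (240 * 0 - (4 : ℂ) * 12⁻¹ * 1 * 1 + (1 / 3 : ℂ) * 1)) :=
      (((tendsto_Sser 3 1).const_mul _).sub ((tendsto_E2.const_mul _).mul tendsto_E4)).add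
        (tendsto_E6.const_mul _)
    rw [show (240 * 0 - (4 : ℂ) * 12⁻¹ * 1 * 1 + (1 / 3 : ℂ) * 1) = 0 by norm_num] at h
    refine h.congr fun z => ?_
    simp only [Pi.add_apply, Pi.smul_apply, serreDerivative_apply, normD_E4, mE2, mE4, mE6,
      smul_eq_mul]
    push_cast
    ring

lemma ram_E6 (z : ℍ) : -504 * Sser 5 1 z = (E2 z * E6 z - E4 z ^ 2) / 2 := by
  have key := eq_zero_of_cusp (k := 8) (by norm_num)
    (serreDerivative ((6 : ℤ) : ℂ) E₆ + (1 / 2 : ℂ) • ((E₄ : ℍ → ℂ) * (E₄ : ℍ → ℂ)))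
    ((serreDerivative_mdifferentiable _ E₆.holo').add
      ((E₄.holo'.mul E₄.holo').const_smul _)) ?_ ?_ z
  · simp only [Pi.add_apply, Pi.mul_apply, Pi.smul_apply, serreDerivative_apply, normD_E6, mE2,
      mE4, mE6, smul_eq_mul] at key
    push_cast at key
    linear_combination key
  · intro γ
    rw [SlashAction.add_slash, ModularForm.SL_smul_slash]
    congr 1
    · exact serreDerivative_slash_invariant (k := 6) E₆.holo' (slash_E6 γ)
    · have := ModularForm.mul_slash_SL2 4 4 γ (E₄ : ℍ → ℂ) (E₄ : ℍ → ℂ)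
      rw [slash_E4] at this
      norm_num at this
      rw [this]
  · have h : Tendsto (fun z : ℍ => -504 * Sser 5 1 z - (6 : ℂ) * 12⁻¹ * (E2 z) * E6 z +
        (1 / 2 : ℂ) * (E4 z * E4 z)) atImInfty
        (𝓝 (-504 * 0 - (6 : ℂ) * 12⁻¹ * 1 * 1 + (1 / 2 : ℂ) * (1 * 1))) :=
      (((tendsto_Sser 5 1).const_mul _).sub ((tendsto_E2.const_mul _).mul tendsto_E6)).add
        ((tendsto_E4.mul tendsto_E4).const_mul _)
    rw [show (-504 * 0 - (6 : ℂ) * 12⁻¹ * 1 * 1 + (1 / 2 : ℂ) * (1 * 1)) = 0 by norm_num] at h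
    refine h.congr fun z => ?_
    simp only [Pi.add_apply, Pi.mul_apply, Pi.smul_apply, serreDerivative_apply, normD_E6, mE2,
      mE4, mE6, smul_eq_mul]
    push_cast
    ring

lemma E2_slash' (γ : SL(2, ℤ)) (z : ℍ) :
    (EisensteinSeries.E2 ∣[(2 : ℤ)] γ) z =
      EisensteinSeries.E2 z + 12 * (2 * (Real.pi : ℂ) * Complex.I)⁻¹ * (γ 1 0 / denom γ z) := by
  rw [EisensteinSeries.E2_slash_action]
  simp only [Pi.sub_apply, Pi.smul_apply, EisensteinSeries.D2, riemannZeta_two, smul_eq_mul]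
  have := Complex.I_sq
  have hp : (Real.pi : ℂ) ≠ 0 := by simp [Real.pi_ne_zero]
  have hd : denom γ z ≠ 0 := denom_ne_zero γ z
  field_simp
  linear_combination (-12 * (γ 1 0 : ℂ)) * this

lemma normD_defect (γ : SL(2, ℤ)) (z : ℍ) :
    normalizedDerivOfComplex (fun z : ℍ => (γ 1 0 : ℂ) / denom γ z) z =
      - (2 * (Real.pi : ℂ) * Complex.I)⁻¹ * (γ 1 0 / denom γ z) ^ 2 := by
  have hd : denom γ z ≠ 0 := denom_ne_zero γ z
  refine normD_eq (G := fun w : ℂ => (γ 1 0 : ℂ) / denom γ w) (fun _ => rfl) ?_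
  have h1 : HasDerivAt (fun w : ℂ => denom γ w) (γ 1 0 : ℂ) (z : ℂ) := by
    simpa [denom] using (hasDerivAt_id (z : ℂ)).const_mul (γ 1 0 : ℂ) |>.add_const (γ 1 1 : ℂ)
  refine ((hasDerivAt_const (z : ℂ) (γ 1 0 : ℂ)).div h1 hd).congr_deriv ?_
  have := two_pi_I_ne
  field_simp
  ring

lemma ram_E2_slash (γ : SL(2, ℤ)) :
    (normalizedDerivOfComplex EisensteinSeries.E2 -
      (1 / 12 : ℂ) • (EisensteinSeries.E2 * EisensteinSeries.E2)) ∣[(4 : ℤ)] γ =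
    normalizedDerivOfComplex EisensteinSeries.E2 -
      (1 / 12 : ℂ) • (EisensteinSeries.E2 * EisensteinSeries.E2) := by
  ext z
  have h1 := congrFun (normalizedDerivOfComplex_SL_slash (k := 2) E2_mdifferentiable (γ := γ)) z
  have hfun : EisensteinSeries.E2 ∣[(2 : ℤ)] γ = EisensteinSeries.E2 +
      (12 * (2 * (Real.pi : ℂ) * Complex.I)⁻¹) • (fun z : ℍ => (γ 1 0 : ℂ) / denom γ z) := by
    ext z
    rw [E2_slash']
    rfl
  have hdd : MDiff (fun z : ℍ => (γ 1 0 : ℂ) / denom γ z) := by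
    have := (mdifferentiable_inv_denom (γ : GL (Fin 2) ℝ)).const_smul (γ 1 0 : ℂ)
    have he : (fun z : ℍ => (γ 1 0 : ℂ) / denom γ z) =
        (γ 1 0 : ℂ) • fun z : ℍ => (denom γ z)⁻¹ := by
      ext z
      simp only [Pi.smul_apply, smul_eq_mul, div_eq_mul_inv]
    rw [he]
    exact this
  have h2 : normalizedDerivOfComplex (EisensteinSeries.E2 ∣[(2 : ℤ)] γ) z =
      normalizedDerivOfComplex EisensteinSeries.E2 z + (12 * (2 * (Real.pi : ℂ) * Complex.I)⁻¹) *
        (-(2 * (Real.pi : ℂ) * Complex.I)⁻¹ * ((γ 1 0 : ℂ) / denom γ z) ^ 2) := by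
    rw [hfun, normalizedDerivOfComplex_add _ _ E2_mdifferentiable (hdd.const_smul _),
      normalizedDerivOfComplex_smul _ _ hdd, Pi.add_apply, Pi.smul_apply, normD_defect,
      smul_eq_mul]
  have h3 := congrFun (ModularForm.mul_slash_SL2 2 2 γ EisensteinSeries.E2 EisensteinSeries.E2) z
  norm_num only [Pi.mul_apply, E2_slash'] at h3
  rw [h2] at h1
  simp only [Pi.sub_apply, E2_slash', smul_eq_mul] at h1
  norm_num only at h1
  rw [sub_eq_add_neg, SlashAction.add_slash, SlashAction.neg_slash, ModularForm.SL_smul_slash]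
  simp only [Pi.add_apply, Pi.neg_apply, Pi.smul_apply, Pi.mul_apply, smul_eq_mul]
  rw [h3]
  push_cast at h1
  linear_combination -h1

lemma ram_E2 (z : ℍ) : -24 * Sser 1 1 z = (E2 z ^ 2 - E4 z) / 12 := by
  have key := eq_zero_of_cusp (k := 4) (by norm_num)
    ((normalizedDerivOfComplex EisensteinSeries.E2 -
      (1 / 12 : ℂ) • (EisensteinSeries.E2 * EisensteinSeries.E2)) + (1 / 12 : ℂ) • (E₄ : ℍ → ℂ))
    (((normalizedDerivOfComplex_mdifferentiable E2_mdifferentiable).sub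
      ((E2_mdifferentiable.mul E2_mdifferentiable).const_smul _)).add (E₄.holo'.const_smul _))
    ?_ ?_ z
  · simp only [Pi.add_apply, Pi.sub_apply, Pi.mul_apply, Pi.smul_apply, normD_E2, mE2, mE4,
      smul_eq_mul] at key
    linear_combination key
  · intro γ
    rw [SlashAction.add_slash, ModularForm.SL_smul_slash, slash_E4, ram_E2_slash]
  · have h : Tendsto (fun z : ℍ => -24 * Sser 1 1 z - (1 / 12 : ℂ) * (E2 z * E2 z) +
        (1 / 12 : ℂ) * E4 z) atImInfty
        (𝓝 (-24 * 0 - (1 / 12 : ℂ) * (1 * 1) + (1 / 12 : ℂ) * 1)) :=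
      (((tendsto_Sser 1 1).const_mul _).sub ((tendsto_E2.mul tendsto_E2).const_mul _)).add
        (tendsto_E4.const_mul _)
    rw [show (-24 * 0 - (1 / 12 : ℂ) * (1 * 1) + (1 / 12 : ℂ) * 1) = 0 by norm_num] at h
    refine h.congr fun z => ?_
    simp only [Pi.add_apply, Pi.sub_apply, Pi.mul_apply, Pi.smul_apply, normD_E2, mE2, mE4,
      smul_eq_mul]

end

noncomputable section
open Complex UpperHalfPlane Filter Topology

lemma hdE2 {τ : ℂ} (h : τ ∈ UHP) :
    HasDerivAt E2 (2 * (Real.pi : ℂ) * Complex.I * ((E2 τ ^ 2 - E4 τ) / 12)) τ := by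
  have := ram_E2 ⟨τ, h⟩
  exact (hasDerivAt_E2' h).congr_deriv (congrArg _ this)

lemma hdE4 {τ : ℂ} (h : τ ∈ UHP) :
    HasDerivAt E4 (2 * (Real.pi : ℂ) * Complex.I * ((E2 τ * E4 τ - E6 τ) / 3)) τ := by
  have := ram_E4 ⟨τ, h⟩
  exact (hasDerivAt_E4' h).congr_deriv (congrArg _ this)

lemma hdE6 {τ : ℂ} (h : τ ∈ UHP) :
    HasDerivAt E6 (2 * (Real.pi : ℂ) * Complex.I * ((E2 τ * E6 τ - E4 τ ^ 2) / 2)) τ := by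
  have := ram_E6 ⟨τ, h⟩
  exact (hasDerivAt_E6' h).congr_deriv (congrArg _ this)

lemma DE4_ram {τ : ℂ} (h : τ ∈ UHP) : DE4 τ = (E2 τ * E4 τ - E6 τ) / 3 := by
  rw [DE4_eq]; exact ram_E4 ⟨τ, h⟩

lemma eta_fun : ModularForm.eta = dedekindEta := funext eta_eq_dedekindEta

lemma eta_ne {τ : ℂ} (h : τ ∈ UHP) : dedekindEta τ ≠ 0 := by
  rw [← eta_fun]; exact ModularForm.eta_ne_zero h

lemma hdEta {τ : ℂ} (h : τ ∈ UHP) :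
    HasDerivAt dedekindEta
      (2 * (Real.pi : ℂ) * Complex.I * (E2 τ / 24 * dedekindEta τ)) τ := by
  have h1 := ModularForm.logDeriv_eta_eq_E2 ⟨τ, h⟩
  have h2 := ModularForm.differentiableAt_eta_of_mem_upperHalfPlaneSet h
  rw [mE2, eta_fun, logDeriv_apply] at h1
  rw [eta_fun] at h2
  refine h2.hasDerivAt.congr_deriv ?_
  have h3 := eta_ne h
  change deriv dedekindEta τ / dedekindEta τ = Real.pi * Complex.I / 12 * E2 τ at h1
  rw [div_eq_iff h3] at h1
  rw [h1]; ring

lemma Delta_eq {τ : ℂ} (h : τ ∈ UHP) : Delta τ = (E4 τ ^ 3 - E6 τ ^ 2) / 1728 := by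
  have h1 := ModularForm.discriminant_eq_E₄_cube_sub_E₆_sq ⟨τ, h⟩
  rw [mE4, mE6] at h1
  rw [← show _ = (E4 τ ^ 3 - E6 τ ^ 2) / 1728 from h1]
  simp [ModularForm.discriminant, Delta, eta_fun]

lemma hdDelta {τ : ℂ} (h : τ ∈ UHP) :
    HasDerivAt Delta (2 * (Real.pi : ℂ) * Complex.I * (E2 τ * Delta τ)) τ := by
  refine ((hdEta h).pow 24).congr_deriv ?_
  simp only [Delta]; push_cast; ring

/-- `η⁻⁵⁸`. -/
def wE (τ : ℂ) : ℂ := (dedekindEta τ ^ 58)⁻¹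

lemma hdw {τ : ℂ} (h : τ ∈ UHP) :
    HasDerivAt wE (2 * (Real.pi : ℂ) * Complex.I * (-(29 / 12) * E2 τ * wE τ)) τ := by
  have h3 := eta_ne h
  refine (((hdEta h).pow 58).inv (pow_ne_zero _ h3)).congr_deriv ?_
  simp only [wE, Pi.pow_apply]
  field_simp
  push_cast; ring

def fU (τ : ℂ) : ℂ := E6 τ ^ 4 + 1341 * E6 τ ^ 2 * Delta τ + 201894 * Delta τ ^ 2
def fV (τ : ℂ) : ℂ := E4 τ ^ 2 * (2 * E6 τ ^ 3 + 1341 * E6 τ * Delta τ)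
def fN (τ : ℂ) : ℂ := (E2 τ * E4 τ - E6 τ) / 3
def fM (τ : ℂ) : ℂ := ((E2 τ ^ 2 - E4 τ) / 12 * E4 τ + E2 τ * ((E2 τ * E4 τ - E6 τ) / 3)
    - (E2 τ * E6 τ - E4 τ ^ 2) / 2) / 3
def fW (τ : ℂ) : ℂ := E6 τ ^ 3 * Delta τ + 879 * E6 τ * Delta τ ^ 2
def fX (τ : ℂ) : ℂ := E4 τ ^ 2 / 2 * (3 * E6 τ ^ 2 * Delta τ + 879 * Delta τ ^ 2)


lemma hdU {τ : ℂ} (h : τ ∈ UHP) : HasDerivAt fU ((2 * (Real.pi : ℂ) * Complex.I) * (2 * E2 τ * fU τ - fV τ)) τ := by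
  have hC := hdE6 h
  have hd := hdDelta h
  refine (((hC.pow 4).add (((hC.pow 2).const_mul 1341).mul hd)).add
    ((hd.pow 2).const_mul 201894)).congr_deriv ?_
  simp only [fU, fV, Pi.pow_apply]
  push_cast; ring

lemma hdV {τ : ℂ} (h : τ ∈ UHP) : HasDerivAt fV ((2 * (Real.pi : ℂ) * Complex.I) * (2 * E4 τ * ((E2 τ * E4 τ - E6 τ) / 3) *
    (2 * E6 τ ^ 3 + 1341 * E6 τ * Delta τ) + E4 τ ^ 2 *
    ((6 * E6 τ ^ 2 + 1341 * Delta τ) * ((E2 τ * E6 τ - E4 τ ^ 2) / 2)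
      + 1341 * E6 τ * (E2 τ * Delta τ)))) τ := by
  have hB := hdE4 h
  have hC := hdE6 h
  have hd := hdDelta h
  refine ((hB.pow 2).mul (((hC.pow 3).const_mul 2).add
    ((hC.const_mul 1341).mul hd))).congr_deriv ?_
  simp only [Pi.pow_apply, Pi.add_apply, Pi.mul_apply]
  push_cast; ring

lemma hdN {τ : ℂ} (h : τ ∈ UHP) : HasDerivAt fN ((2 * (Real.pi : ℂ) * Complex.I) * fM τ) τ := by
  refine ((((hdE2 h).mul (hdE4 h)).sub (hdE6 h)).div_const 3).congr_deriv ?_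
  simp only [fM]; ring

lemma hdM {τ : ℂ} (h : τ ∈ UHP) : HasDerivAt fM ((2 * (Real.pi : ℂ) * Complex.I) * (
    ((2 * E2 τ * ((E2 τ ^ 2 - E4 τ) / 12) - (E2 τ * E4 τ - E6 τ) / 3) / 12 * E4 τ
      + (E2 τ ^ 2 - E4 τ) / 12 * ((E2 τ * E4 τ - E6 τ) / 3)
      + (E2 τ ^ 2 - E4 τ) / 12 * ((E2 τ * E4 τ - E6 τ) / 3) + E2 τ * fM τ
      - ((E2 τ ^ 2 - E4 τ) / 12 * E6 τ + E2 τ * ((E2 τ * E6 τ - E4 τ ^ 2) / 2)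
        - 2 * E4 τ * ((E2 τ * E4 τ - E6 τ) / 3)) / 2) / 3)) τ := by
  have hA := hdE2 h
  have hB := hdE4 h
  have hC := hdE6 h
  refine ((((((hA.pow 2).sub hB).div_const 12).mul hB).add
    (hA.mul (((hA.mul hB).sub hC).div_const 3))).sub
    (((hA.mul hC).sub (hB.pow 2)).div_const 2) |>.div_const 3).congr_deriv ?_
  simp only [fM, Pi.pow_apply, Pi.add_apply, Pi.mul_apply, Pi.sub_apply]
  push_cast; ring

lemma hdW {τ : ℂ} (h : τ ∈ UHP) : HasDerivAt fW ((2 * (Real.pi : ℂ) * Complex.I) * (5 / 2 * E2 τ * fW τ - fX τ)) τ := by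
  have hC := hdE6 h
  have hd := hdDelta h
  refine (((hC.pow 3).mul hd).add ((hC.const_mul 879).mul (hd.pow 2))).congr_deriv ?_
  simp only [fW, fX, Pi.pow_apply]
  push_cast; ring

lemma hdX {τ : ℂ} (h : τ ∈ UHP) : HasDerivAt fX ((2 * (Real.pi : ℂ) * Complex.I) * (
    E4 τ * ((E2 τ * E4 τ - E6 τ) / 3) * (3 * E6 τ ^ 2 * Delta τ + 879 * Delta τ ^ 2)
    + E4 τ ^ 2 / 2 * (6 * E6 τ * ((E2 τ * E6 τ - E4 τ ^ 2) / 2) * Delta τ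
      + 3 * E6 τ ^ 2 * (E2 τ * Delta τ) + 879 * 2 * (E2 τ * Delta τ ^ 2)))) τ := by
  have hB := hdE4 h
  have hC := hdE6 h
  have hd := hdDelta h
  refine (((hB.pow 2).div_const 2).mul ((((hC.pow 2).const_mul 3).mul hd).add
    ((hd.pow 2).const_mul 879))).congr_deriv ?_
  simp only [Pi.pow_apply, Pi.add_apply, Pi.mul_apply]
  push_cast; ring

/-- The character on the upper half-plane. -/
def fF (τ : ℂ) : ℂ := (1 / 38818159380) * ((fU τ * fN τ / 240 - fW τ) * wE τ)

/-- The normalized derivative of the character on the upper half-plane. -/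
def fG (τ : ℂ) : ℂ := (1 / 38818159380) * ((((2 * E2 τ * fU τ - fV τ) * fN τ + fU τ * fM τ) / 240
    - (5 / 2 * E2 τ * fW τ - fX τ) - 29 / 12 * E2 τ * (fU τ * fN τ / 240 - fW τ)) * wE τ)

lemma charE8_eq {τ : ℂ} (h : τ ∈ UHP) : charE8 τ = fF τ := by
  have h3 := eta_ne h
  simp only [charE8, fF, DE4_ram h, fU, fN, fW, wE]
  field_simp

lemma hdF {τ : ℂ} (h : τ ∈ UHP) : HasDerivAt fF ((2 * (Real.pi : ℂ) * Complex.I) * fG τ) τ := by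
  refine ((((((hdU h).mul (hdN h)).div_const 240).sub (hdW h)).mul (hdw h)).const_mul
    (1 / 38818159380 : ℂ)).congr_deriv ?_
  simp only [fG, Pi.mul_apply, Pi.sub_apply]
  ring

lemma hdChar {τ : ℂ} (h : τ ∈ UHP) : HasDerivAt charE8 ((2 * (Real.pi : ℂ) * Complex.I) * fG τ) τ :=
  (hdF h).congr_of_eventuallyEq
    (Filter.eventually_of_mem (isOpen_UHP.mem_nhds h) fun _ hx => charE8_eq hx)

lemma Dop_char {τ : ℂ} (h : τ ∈ UHP) : Dop charE8 τ = fG τ := by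
  rw [Dop, (hdChar h).deriv, inv_mul_cancel_left₀ two_pi_I_ne]

lemma hdG {τ : ℂ} (h : τ ∈ UHP) : HasDerivAt fG
    ((2 * (Real.pi : ℂ) * Complex.I) * (1 / 6 * E2 τ * fG τ + 899 / 144 * E4 τ * fF τ)) τ := by
  have hA := hdE2 h
  have hUN := (((hdU h).mul (hdN h)).div_const 240).sub (hdW h)
  refine ((((((((hA.const_mul 2).mul (hdU h)).sub (hdV h)).mul (hdN h)).add
    ((hdU h).mul (hdM h))).div_const 240).sub
    (((hA.const_mul (5 / 2)).mul (hdW h)).sub (hdX h))).sub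
    ((hA.const_mul (29 / 12)).mul hUN) |>.mul (hdw h) |>.const_mul
    (1 / 38818159380 : ℂ)).congr_deriv ?_
  simp only [fG, fF, fM, fN, fU, fV, fW, fX, Pi.mul_apply, Pi.sub_apply, Pi.add_apply]
  rw [Delta_eq h]
  generalize E2 τ = a
  generalize E4 τ = b
  generalize E6 τ = c
  generalize wE τ = w
  generalize (2 * (Real.pi : ℂ) * Complex.I) = t
  ring

end

theorem charE8_holo_and_MLDE :
    DifferentiableOn ℂ charE8 UHP ∧
      ∀ τ ∈ UHP,
        Dop (Dop charE8) τ - (1 / 6 : ℂ) * E2 τ * Dop charE8 τ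
          - (899 / 144 : ℂ) * E4 τ * charE8 τ = 0 := by
  refine ⟨fun τ h => (hdChar h).differentiableAt.differentiableWithinAt, fun τ h => ?_⟩
  have h1 : Dop (Dop charE8) τ = 1 / 6 * E2 τ * fG τ + 899 / 144 * E4 τ * fF τ := by
    have h2 : HasDerivAt (Dop charE8) _ τ := (hdG h).congr_of_eventuallyEq
      (Filter.eventually_of_mem (isOpen_UHP.mem_nhds h) fun _ hx => Dop_char hx)
    rw [Dop, h2.deriv, inv_mul_cancel_left₀ two_pi_I_ne]
  rw [h1, Dop_char h, charE8_eq h]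
  ring
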